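/- Let q ≥ 2 and let n, k be natural numbers with k ≤ n and set m := n − k. Given integer matrices X₂ ∈ ℤ^{m×k}, Z₁ ∈ ℤ^{m×m}, Z₂ ∈ ℤ^{m×k} all of whose entries lie in {0, 1, …, q−1}, form the canonical-form rows r_1,…,r_m ∈ ℤ^{2n} whose x-part is the corresponding row of the block matrix [I_m X₂] and whose z-part is the corresponding row of [Z₁ Z₂]. Define L⁻ ∈ ℤ^{m×m} by L⁻_{ij} = min(⟨r_i, r_j⟩, 0), and let r'_1,…,r'_m be the modified rows whose x-part is unchanged and whose z-part is the corresponding row of [Z₁ + L⁻ Z₂]. Then ⟨r'_i, r'_j⟩ = 0 over ℤ for all i, j, and every entry of every modified row r'_i has absolute value at most (1 + k(q−1))(q−1). -/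

import Mathlib

open Matrix BigOperators

/-- Symplectic product of two vectors in `ℤ^{2n}`, given by their x- and z-parts:
`⟨u, v⟩ = ∑ t, (v_z t * u_x t - v_x t * u_z t)`. -/
def sympProd {ι : Type*} [Fintype ι] (ux uz vx vz : ι → ℤ) : ℤ :=
  ∑ t, (vz t * ux t - vx t * uz t)

/-- The symplectic product is antisymmetric. -/
theorem sympProd_swap {ι : Type*} [Fintype ι] (ux uz vx vz : ι → ℤ) :
    sympProd ux uz vx vz = -sympProd vx vz ux uz := by
  simp only [sympProd, ← Finset.sum_neg_distrib]
  exact Finset.sum_congr rfl fun t _ => by ring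

/-- The symplectic product of two rows whose x-parts begin with rows of the identity matrix. -/
theorem sympProd_canonical {ι κ : Type*} [Fintype ι] [DecidableEq ι] [Fintype κ]
    (i j : ι) (a b : ι → ℤ) (ux uz vx vz : κ → ℤ) :
    sympProd (Sum.elim (fun t => if i = t then (1 : ℤ) else 0) ux) (Sum.elim a uz)
      (Sum.elim (fun t => if j = t then (1 : ℤ) else 0) vx) (Sum.elim b vz) =
      b i - a j + sympProd ux uz vx vz := by
  simp [sympProd, Fintype.sum_sum_type, Finset.sum_sub_distrib]
  ring

/-- Vectors with entries in `[0, c]` have symplectic product at most `c ^ 2` per coordinate. -/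
theorem abs_sympProd_le {ι : Type*} [Fintype ι] {c : ℤ} {ux uz vx vz : ι → ℤ}
    (hux : ∀ t, 0 ≤ ux t ∧ ux t ≤ c) (huz : ∀ t, 0 ≤ uz t ∧ uz t ≤ c)
    (hvx : ∀ t, 0 ≤ vx t ∧ vx t ≤ c) (hvz : ∀ t, 0 ≤ vz t ∧ vz t ≤ c) :
    |sympProd ux uz vx vz| ≤ Fintype.card ι * c ^ 2 := by
  have hterm : ∀ t, |vz t * ux t - vx t * uz t| ≤ c ^ 2 := fun t => by
    obtain ⟨h₁, h₁'⟩ := hux t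
    obtain ⟨h₂, h₂'⟩ := huz t
    obtain ⟨h₃, h₃'⟩ := hvx t
    obtain ⟨h₄, h₄'⟩ := hvz t
    have hc : 0 ≤ c := h₁.trans h₁'
    have hp := mul_le_mul h₄' h₁' h₁ hc
    have hn := mul_le_mul h₃' h₂' h₂ hc
    have hp₀ := mul_nonneg h₄ h₁
    have hn₀ := mul_nonneg h₃ h₂
    rw [abs_le, sq]
    constructor <;> linarith
  calc |sympProd ux uz vx vz| ≤ ∑ t, |vz t * ux t - vx t * uz t| :=
        Finset.abs_sum_le_sum_abs _ _
    _ ≤ ∑ _t : ι, c ^ 2 := Finset.sum_le_sum fun t _ => hterm t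
    _ = Fintype.card ι * c ^ 2 := by simp

/-- The `L⁻` variant of the LDI form construction: starting from canonical-form rows
`[I_m X₂ | Z₁ Z₂]` with entries in `{0, …, q-1}`, adding `L⁻_{ij} = min(⟨r_i, r_j⟩, 0)`
to `Z₁` makes all pairwise symplectic products vanish over `ℤ`, and every entry of
every modified row has absolute value at most `(1 + k(q-1))(q-1)`. -/
theorem ldi_minus_form (q n k : ℕ) (hq : 2 ≤ q) (hk : k ≤ n)
    (X₂ : Matrix (Fin (n - k)) (Fin k) ℤ)
    (Z₁ : Matrix (Fin (n - k)) (Fin (n - k)) ℤ)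
    (Z₂ : Matrix (Fin (n - k)) (Fin k) ℤ)
    (hX₂ : ∀ i j, 0 ≤ X₂ i j ∧ X₂ i j ≤ (q : ℤ) - 1)
    (hZ₁ : ∀ i j, 0 ≤ Z₁ i j ∧ Z₁ i j ≤ (q : ℤ) - 1)
    (hZ₂ : ∀ i j, 0 ≤ Z₂ i j ∧ Z₂ i j ≤ (q : ℤ) - 1)
    (x z z' : Fin (n - k) → (Fin (n - k) ⊕ Fin k) → ℤ)
    (L : Matrix (Fin (n - k)) (Fin (n - k)) ℤ)
    (hx : ∀ i, x i = Sum.elim (fun j => if i = j then (1 : ℤ) else 0) (X₂ i))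
    (hz : ∀ i, z i = Sum.elim (Z₁ i) (Z₂ i))
    (hL : ∀ i j, L i j = min (sympProd (x i) (z i) (x j) (z j)) 0)
    (hz' : ∀ i, z' i = Sum.elim (fun j => Z₁ i j + L i j) (Z₂ i)) :
    (∀ i j, sympProd (x i) (z' i) (x j) (z' j) = 0) ∧
    (∀ i t, |Sum.elim (x i) (z' i) t| ≤ (1 + (k : ℤ) * ((q : ℤ) - 1)) * ((q : ℤ) - 1)) := by
  have hS : ∀ i j, sympProd (x i) (z i) (x j) (z j) =
      Z₁ j i - Z₁ i j + sympProd (X₂ i) (Z₂ i) (X₂ j) (Z₂ j) := fun i j => by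
    rw [hx, hz, hx, hz, sympProd_canonical]
  have hLeq : ∀ i j, L i j =
      min (Z₁ j i - Z₁ i j + sympProd (X₂ i) (Z₂ i) (X₂ j) (Z₂ j)) 0 := fun i j => by
    rw [hL, hS]
  refine ⟨fun i j => ?_, fun i t => ?_⟩
  · rw [hx, hz', hx, hz', sympProd_canonical, hLeq i j, hLeq j i, sympProd_swap (X₂ j)]
    omega
  · have hq' : (1 : ℤ) ≤ (q : ℤ) - 1 := by omega
    have hnn : 0 ≤ (k : ℤ) * ((q : ℤ) - 1) ^ 2 := by positivity
    have hB : (1 + (k : ℤ) * ((q : ℤ) - 1)) * ((q : ℤ) - 1) =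
        ((q : ℤ) - 1) + k * ((q : ℤ) - 1) ^ 2 := by ring
    rw [hB, hx, hz']
    rcases t with (j | j) | (j | j) <;> simp only [Sum.elim_inl, Sum.elim_inr]
    · split_ifs <;> simp only [abs_one, abs_zero] <;> linarith
    · have := hX₂ i j
      rw [abs_le]
      constructor <;> linarith
    · have hS₂ := abs_le.mp (abs_sympProd_le (hX₂ i) (hZ₂ i) (hX₂ j) (hZ₂ j))
      rw [Fintype.card_fin] at hS₂
      have h₁ := hZ₁ i j
      have h₂ := hZ₁ j i
      rw [hLeq, abs_le]
      rcases min_choice (Z₁ j i - Z₁ i j + sympProd (X₂ i) (Z₂ i) (X₂ j) (Z₂ j)) 0 with h | h <;>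
        rw [h] <;> constructor <;> linarith
    · have := hZ₂ i j
      rw [abs_le]
      constructor <;> linarith
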